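/- arXiv:1912.08183 — 4 statements merged into one kernel-verified Lean document; each statement's English description precedes it below -/
import Mathlib

section
/- Let 0 < ε ≤ 10⁻² and let φ₂, φ₄ be real numbers with |φ₂| ≤ ε/4 and 0 ≤ φ₄ ≤ ε/32. Then for every μ_max > 0 there exists a smooth function f₂ : [0, μ_max] → ℝ such that the mean field flow hierarchy (f_n^{(μ_max)}) generated by f₂ consists of smooth functions and satisfies the pure φ⁴ boundary conditions f₂^{(μ_max)}(0) = φ₂, f₄^{(μ_max)}(0) = φ₄ and f_n^{(μ_max)}(0) = 0 for all even n ≥ 6; moreover these solutions vanish in the ultraviolet limit: for every even n ≥ 2 and every integer l ≥ 0, lim_{μ_max → ∞} (f_n^{(μ_max)})^{(l)}(μ_max) = 0. -/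
noncomputable def mfPairSum (f : ℕ → ℝ → ℝ) (n : ℕ) (μ : ℝ) : ℝ :=
  ∑ n₁ ∈ Finset.range (n + 3),
    if Even n₁ ∧ 4 ≤ n₁ ∧ n₁ + 2 ≤ n then f n₁ μ * f (n + 2 - n₁) μ else 0

def MeanFieldHierarchy (μmax : ℝ) (f : ℕ → ℝ → ℝ) : Prop :=
  (∀ n, ContDiff ℝ (⊤ : ℕ∞) (f n)) ∧
  (∀ μ ∈ Set.Icc (0 : ℝ) μmax,
      f 4 μ = (1 / 3) * f 2 μ * (f 2 μ - 1) + (1 / 3) * deriv (f 2) μ) ∧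
  (∀ n : ℕ, Even n → 4 ≤ n → ∀ μ ∈ Set.Icc (0 : ℝ) μmax,
      f (n + 2) μ =
        (1 / ((n : ℝ) + 1)) * mfPairSum f n μ
          + (1 / ((n : ℝ) + 1)) * f n μ * (2 * f 2 μ + 1 - 4 / (n : ℝ))
          + (2 / ((n : ℝ) * ((n : ℝ) + 1))) * deriv (f n) μ)

/-- **Borel's lemma**, with a compactly supported realization. -/
theorem exists_contDiff_iteratedDeriv_zero_eq (a : ℕ → ℝ) :
    ∃ f : ℝ → ℝ, ContDiff ℝ (⊤ : ℕ∞) f ∧ (∀ x, 2 ≤ |x| → f x = 0) ∧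
      ∀ k, iteratedDeriv k f 0 = a k := by
  let χ : ContDiffBump (0 : ℝ) := ⟨1, 2, one_pos, one_lt_two⟩
  let g : ℕ → ℝ → ℝ := fun k x => (k.factorial : ℝ)⁻¹ * (χ x * x ^ k)
  have hg : ∀ k, ContDiff ℝ (⊤ : ℕ∞) (g k) := fun k =>
    contDiff_const.mul (χ.contDiff.mul (contDiff_id.pow k))
  have hsupp : ∀ k, HasCompactSupport (g k) := fun k =>
    (χ.hasCompactSupport.mul_right (f' := fun x => x ^ k)).mul_left
      (f := fun _ => (k.factorial : ℝ)⁻¹)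
  have hbound : ∀ k i, ∃ M, ∀ x, |iteratedDeriv i (g k) x| ≤ M := by
    intro k i
    obtain ⟨M, hM⟩ := ((hsupp k).iteratedFDeriv (𝕜 := ℝ) i).exists_bound_of_continuous
      ((hg k).continuous_iteratedFDeriv (mod_cast le_top))
    exact ⟨M, fun x => by
      rw [← Real.norm_eq_abs, ← norm_iteratedFDeriv_eq_norm_iteratedDeriv]; exact hM x⟩
  choose M hM using hbound
  have hM0 : ∀ k i, 0 ≤ M k i := fun k i => (abs_nonneg _).trans (hM k i 0)
  let t : ℕ → ℝ := fun k => 1 + |a k| * (∑ i ∈ Finset.range k, M k i) * 2 ^ k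
  have hS0 : ∀ k, 0 ≤ ∑ i ∈ Finset.range k, M k i := fun k =>
    Finset.sum_nonneg fun i _ => hM0 k i
  have ht1 : ∀ k, 1 ≤ t k := fun k => by
    have := hS0 k
    simp only [t, le_add_iff_nonneg_right]
    positivity
  have ht0 : ∀ k, 0 < t k := fun k => one_pos.trans_le (ht1 k)
  let h : ℕ → ℝ → ℝ := fun k x => a k / t k ^ k * g k (t k * x)
  have hh : ∀ k, ContDiff ℝ (⊤ : ℕ∞) (h k) := fun k =>
    contDiff_const.mul ((hg k).comp (contDiff_const.mul contDiff_id))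
  have hder : ∀ i k x, iteratedDeriv i (h k) x =
      a k / t k ^ k * (t k ^ i * iteratedDeriv i (g k) (t k * x)) := by
    intro i k x
    have hc : ContDiff ℝ i (g k) := (hg k).of_le (mod_cast le_top)
    simp only [h]
    rw [iteratedDeriv_const_mul_field, iteratedDeriv_comp_const_mul hc]
  let v : ℕ → ℕ → ℝ := fun i k => |a k| / t k ^ k * (t k ^ i * M k i)
  have hv : ∀ i, Summable (v i) := by
    intro i
    refine Summable.of_norm_bounded_eventually_nat (g := fun k => (1 / 2 : ℝ) ^ k)
      summable_geometric_two ?_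
    filter_upwards [Filter.eventually_gt_atTop i] with k hk
    have hv0 : 0 ≤ v i k := by
      have := hM0 k i
      have := ht0 k
      simp only [v]
      positivity
    rw [Real.norm_of_nonneg hv0]
    have hpow : t k ^ i * t k ≤ t k ^ k := by
      rw [← pow_succ]
      exact pow_le_pow_right₀ (ht1 k) hk
    have hle : |a k| * M k i * 2 ^ k ≤ t k := by
      have h1 : M k i ≤ ∑ i ∈ Finset.range k, M k i :=
        Finset.single_le_sum (f := M k) (fun j _ => hM0 k j) (Finset.mem_range.2 hk)
      have h2 : |a k| * M k i * 2 ^ k ≤ |a k| * (∑ i ∈ Finset.range k, M k i) * 2 ^ k := by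
        gcongr
      simp only [t]
      linarith
    have hv' : v i k = (|a k| * M k i) * t k ^ i / t k ^ k := by
      simp only [v]
      ring
    rw [hv', div_le_iff₀ (pow_pos (ht0 k) k), one_div, inv_pow, inv_mul_eq_div,
      le_div_iff₀ (by positivity)]
    calc |a k| * M k i * t k ^ i * 2 ^ k = t k ^ i * (|a k| * M k i * 2 ^ k) := by ring
      _ ≤ t k ^ i * t k := mul_le_mul_of_nonneg_left hle (pow_nonneg (ht0 k).le i)
      _ ≤ t k ^ k := hpow
  have hbd : ∀ (i k : ℕ) (x : ℝ), ‖iteratedFDeriv ℝ i (h k) x‖ ≤ v i k := by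
    intro i k x
    rw [norm_iteratedFDeriv_eq_norm_iteratedDeriv, hder, Real.norm_eq_abs, abs_mul, abs_mul,
      abs_div, abs_of_pos (pow_pos (ht0 k) k), abs_of_pos (pow_pos (ht0 k) i)]
    have := ht0 k
    simp only [v]
    gcongr
    exact hM k i _
  have hg0 : ∀ i k, iteratedDeriv i (g k) 0 = if i = k then 1 else 0 := by
    intro i k
    have hev : g k =ᶠ[nhds 0] fun x => (k.factorial : ℝ)⁻¹ * x ^ k := by
      filter_upwards [χ.eventuallyEq_one] with x hx
      simp [g, hx]
    rw [hev.iteratedDeriv_eq, iteratedDeriv_const_mul_field, iteratedDeriv_fun_pow_zero]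
    split_ifs with hik
    · subst hik
      simp [Nat.factorial_ne_zero]
    · simp
  have hh0 : ∀ i k, iteratedDeriv i (h k) 0 = if i = k then a k else 0 := by
    intro i k
    rw [hder, mul_zero, hg0]
    split_ifs with hik
    · subst hik
      have := (pow_pos (ht0 i) i).ne'
      field_simp
    · simp
  refine ⟨fun x => ∑' k, h k x, ?_, ?_, ?_⟩
  · exact contDiff_tsum hh (fun i _ => hv i) (fun i k x _ => hbd i k x)
  · intro x hx
    refine (tsum_congr fun k => ?_).trans tsum_zero
    have hχ : χ (t k * x) = 0 := by
      apply χ.zero_of_le_dist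
      rw [dist_zero_right, Real.norm_eq_abs, abs_mul, abs_of_pos (ht0 k)]
      exact hx.trans (le_mul_of_one_le_left (abs_nonneg x) (ht1 k))
    simp [h, g, hχ]
  · intro i
    have key := iteratedFDeriv_tsum_apply (N := ⊤) hh (fun i _ => hv i)
      (fun i k x _ => hbd i k x) (k := i) le_top 0
    rw [iteratedDeriv_eq_iteratedFDeriv, key, tsum_eq_single i,
      ← iteratedDeriv_eq_iteratedFDeriv, hh0, if_pos rfl]
    intro k hk
    rw [← norm_eq_zero, norm_iteratedFDeriv_eq_norm_iteratedDeriv, hh0, if_neg hk.symm, norm_zero]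

/-- The mean field flow hierarchy generated by `f₂`, as functions on all of `ℝ`. -/
noncomputable def meanFieldFlow (f₂ : ℝ → ℝ) : ℕ → ℝ → ℝ
  | n =>
    if n = 2 then f₂
    else if n = 4 then fun μ => (1 / 3) * f₂ μ * (f₂ μ - 1) + (1 / 3) * deriv f₂ μ
    else if hn : Even n ∧ 6 ≤ n then fun μ =>
      (1 / (((n - 2 : ℕ) : ℝ) + 1)) * (∑ n₁ ∈ Finset.range (n + 1),
          if _h : Even n₁ ∧ 4 ≤ n₁ ∧ n₁ + 4 ≤ n then
            meanFieldFlow f₂ n₁ μ * meanFieldFlow f₂ (n - n₁) μ else 0)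
        + (1 / (((n - 2 : ℕ) : ℝ) + 1)) * meanFieldFlow f₂ (n - 2) μ
            * (2 * f₂ μ + 1 - 4 / ((n - 2 : ℕ) : ℝ))
        + (2 / (((n - 2 : ℕ) : ℝ) * (((n - 2 : ℕ) : ℝ) + 1))) * deriv (meanFieldFlow f₂ (n - 2)) μ
    else 0
  termination_by n => n
  decreasing_by all_goals omega

section

variable {f₂ : ℝ → ℝ}

theorem meanFieldFlow_two : meanFieldFlow f₂ 2 = f₂ := by
  rw [meanFieldFlow, if_pos rfl]

theorem meanFieldFlow_four : meanFieldFlow f₂ 4 =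
    fun μ => (1 / 3) * f₂ μ * (f₂ μ - 1) + (1 / 3) * deriv f₂ μ := by
  rw [meanFieldFlow, if_neg (by norm_num), if_pos rfl]

theorem meanFieldFlow_add_two {n : ℕ} (hn : Even n) (h4 : 4 ≤ n) :
    meanFieldFlow f₂ (n + 2) = fun μ =>
      (1 / ((n : ℝ) + 1)) * mfPairSum (meanFieldFlow f₂) n μ
        + (1 / ((n : ℝ) + 1)) * meanFieldFlow f₂ n μ * (2 * f₂ μ + 1 - 4 / (n : ℝ))
        + (2 / ((n : ℝ) * ((n : ℝ) + 1))) * deriv (meanFieldFlow f₂ n) μ := by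
  have he : Even (n + 2) ∧ 6 ≤ n + 2 := ⟨hn.add even_two, by omega⟩
  rw [meanFieldFlow, if_neg (by omega), if_neg (by omega), dif_pos he]
  have hle : ∀ k, k + 4 ≤ n + 2 ↔ k + 2 ≤ n := fun k => by omega
  simp only [Nat.add_sub_cancel, mfPairSum, dite_eq_ite, hle]

/-- Induction along the hierarchy: over even `n ≥ 2`, with `n + 2` reduced to all smaller indices. -/
theorem even_two_le_induction {motive : ℕ → Prop} (two : motive 2) (four : motive 4)
    (step : ∀ n, Even n → 4 ≤ n → (∀ k, Even k → 2 ≤ k → k ≤ n → motive k) → motive (n + 2))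
    {n : ℕ} (hn : Even n) (h2 : 2 ≤ n) : motive n := by
  induction n using Nat.strong_induction_on with
  | _ n ih =>
    obtain rfl | rfl | h6 : n = 2 ∨ n = 4 ∨ 6 ≤ n := by
      obtain ⟨m, rfl⟩ := hn
      omega
    · exact two
    · exact four
    · obtain ⟨m, rfl⟩ : ∃ m, n = m + 2 := ⟨n - 2, by omega⟩
      have hm : Even m := (Nat.even_add.1 hn).2 even_two
      exact step m hm (by omega) fun k hk h2k hkm => ih k (by omega) hk h2k

theorem meanFieldFlow_eq_zero {n : ℕ} (hn : ¬ (Even n ∧ 2 ≤ n)) : meanFieldFlow f₂ n = 0 := by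
  rw [meanFieldFlow, if_neg, if_neg, dif_neg]
  · exact fun h => hn ⟨h.1, by omega⟩
  · rintro rfl
    exact hn ⟨by decide, by norm_num⟩
  · rintro rfl
    exact hn ⟨by decide, le_rfl⟩

theorem contDiff_mfPairSum {f : ℕ → ℝ → ℝ} {n : ℕ}
    (hf : ∀ k, Even k → 4 ≤ k → k ≤ n → ContDiff ℝ (⊤ : ℕ∞) (f k)) (hn : Even n) :
    ContDiff ℝ (⊤ : ℕ∞) (mfPairSum f n) := by
  unfold mfPairSum
  refine ContDiff.sum fun k _ => ?_
  split_ifs with h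
  · obtain ⟨hk, h4, hkn⟩ := h
    exact (hf k hk h4 (by omega)).mul
      (hf _ ((Nat.even_sub (by omega)).2 (by simp [hk, Nat.even_add, hn])) (by omega) (by omega))
  · exact contDiff_const

theorem contDiff_meanFieldFlow (hf : ContDiff ℝ (⊤ : ℕ∞) f₂) (n : ℕ) :
    ContDiff ℝ (⊤ : ℕ∞) (meanFieldFlow f₂ n) := by
  have hderiv : ∀ {g : ℝ → ℝ}, ContDiff ℝ (⊤ : ℕ∞) g → ContDiff ℝ (⊤ : ℕ∞) (deriv g) :=
    fun hg => (contDiff_infty_iff_deriv.1 hg).2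
  by_cases hn : Even n ∧ 2 ≤ n
  · refine even_two_le_induction (motive := fun n => ContDiff ℝ (⊤ : ℕ∞) (meanFieldFlow f₂ n))
      ?_ ?_ ?_ hn.1 hn.2
    · rwa [meanFieldFlow_two]
    · rw [meanFieldFlow_four]
      have := hderiv hf
      fun_prop
    · intro n hn h4 ih
      rw [meanFieldFlow_add_two hn h4]
      have hd := hderiv (ih n hn (by omega) le_rfl)
      have hm := ih n hn (by omega) le_rfl
      have hs := contDiff_mfPairSum (n := n) (fun k hk h4 hkn => ih k hk (by omega) hkn) hn
      fun_prop
  · rw [meanFieldFlow_eq_zero hn]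
    exact contDiff_const

theorem meanFieldFlow_eqOn_zero {U : Set ℝ} (hU : IsOpen U) (hf : Set.EqOn f₂ 0 U)
    {n : ℕ} (hn : Even n) (h2 : 2 ≤ n) : Set.EqOn (meanFieldFlow f₂ n) 0 U := by
  have hderiv : ∀ {g : ℝ → ℝ}, Set.EqOn g 0 U → ∀ μ ∈ U, deriv g μ = 0 := fun hg μ hμ => by
    rw [(hg.eventuallyEq_of_mem (hU.mem_nhds hμ)).deriv_eq]
    simp
  refine even_two_le_induction (motive := fun n => Set.EqOn (meanFieldFlow f₂ n) 0 U)
    ?_ ?_ ?_ hn h2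
  · rwa [meanFieldFlow_two]
  · intro μ hμ
    simp [meanFieldFlow_four, hf hμ, hderiv hf μ hμ]
  · intro n hn h4 ih μ hμ
    have hs : mfPairSum (meanFieldFlow f₂) n μ = 0 := by
      refine Finset.sum_eq_zero fun k _ => ?_
      split_ifs with h
      · simp [ih k h.1 (by omega) (by omega) hμ]
      · rfl
    simp [meanFieldFlow_add_two hn h4, hs, ih n hn (by omega) le_rfl hμ,
      hderiv (ih n hn (by omega) le_rfl) μ hμ]

/-- The polynomial counterpart of `mfPairSum`, in the variables `X n`. -/
noncomputable def pairSumPoly (n : ℕ) : MvPolynomial ℕ ℝ :=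
  ∑ n₁ ∈ Finset.range (n + 3),
    if Even n₁ ∧ 4 ≤ n₁ ∧ n₁ + 2 ≤ n then MvPolynomial.X n₁ * MvPolynomial.X (n + 2 - n₁) else 0

open MvPolynomial in
/-- The hierarchy solved for the derivatives: the vector field whose integral curves are the
solutions of the mean field flow equations. -/
noncomputable def flowDerivation : Derivation ℝ (MvPolynomial ℕ ℝ) (MvPolynomial ℕ ℝ) :=
  MvPolynomial.mkDerivation ℝ fun n =>
    if n = 2 then C 3 * X 4 - X 2 * (X 2 - 1)
    else C ((n : ℝ) * (n + 1) / 2) * (X (n + 2) - C (1 / ((n : ℝ) + 1)) * pairSumPoly n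
      - C (1 / ((n : ℝ) + 1)) * X n * (C 2 * X 2 + C (1 - 4 / (n : ℝ))))

/-- `f` is smooth and its derivatives at `0` are those of the polynomial observable `P` along the
vector field `D`, evaluated at the point `x`. -/
def IsJetOf {σ : Type*} (D : Derivation ℝ (MvPolynomial σ ℝ) (MvPolynomial σ ℝ)) (x : σ → ℝ)
    (f : ℝ → ℝ) (P : MvPolynomial σ ℝ) : Prop :=
  ContDiff ℝ (⊤ : ℕ∞) f ∧ ∀ j, iteratedDeriv j f 0 = MvPolynomial.eval x (D^[j] P)

namespace IsJetOf

variable {σ : Type*} {D : Derivation ℝ (MvPolynomial σ ℝ) (MvPolynomial σ ℝ)} {x : σ → ℝ}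
  {f g : ℝ → ℝ} {P Q : MvPolynomial σ ℝ}

theorem apply_zero (h : IsJetOf D x f P) : f 0 = MvPolynomial.eval x P := by
  simpa using h.2 0

theorem deriv (h : IsJetOf D x f P) : IsJetOf D x (deriv f) (D P) :=
  ⟨(contDiff_infty_iff_deriv.1 h.1).2, fun j => by
    rw [← iteratedDeriv_succ', h.2, Function.iterate_succ_apply]⟩

theorem const (c : ℝ) : IsJetOf D x (fun _ => c) (MvPolynomial.C c) := by
  refine ⟨contDiff_const, fun j => ?_⟩
  cases j with
  | zero => simp
  | succ j =>
    have hD : D (MvPolynomial.C c) = 0 := D.map_algebraMap c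
    rw [Function.iterate_succ_apply, hD, iterate_map_zero, iteratedDeriv_const]
    simp

theorem add (hf : IsJetOf D x f P) (hg : IsJetOf D x g Q) :
    IsJetOf D x (fun μ => f μ + g μ) (P + Q) := by
  refine ⟨hf.1.add hg.1, fun j => ?_⟩
  have h := iteratedDeriv_add (n := j) (x := (0 : ℝ)) (hf.1.contDiffAt.of_le (mod_cast le_top))
    (hg.1.contDiffAt.of_le (mod_cast le_top))
  rw [iterate_map_add, map_add, ← hf.2, ← hg.2, ← h]
  rfl

theorem mul (hf : IsJetOf D x f P) (hg : IsJetOf D x g Q) :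
    IsJetOf D x (fun μ => f μ * g μ) (P * Q) := by
  refine ⟨hf.1.mul hg.1, fun j => ?_⟩
  induction j generalizing f g P Q with
  | zero => simp [hf.apply_zero, hg.apply_zero]
  | succ j ih =>
    have hd : _root_.deriv (fun μ => f μ * g μ) =
        (fun μ => f μ * _root_.deriv g μ) + fun μ => g μ * _root_.deriv f μ := by
      funext μ
      rw [deriv_fun_mul (hf.1.differentiable (by simp) μ) (hg.1.differentiable (by simp) μ)]
      simp only [Pi.add_apply]
      ring
    rw [iteratedDeriv_succ', hd, iteratedDeriv_add
      ((hf.1.mul hg.deriv.1).contDiffAt.of_le (mod_cast le_top))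
      ((hg.1.mul hf.deriv.1).contDiffAt.of_le (mod_cast le_top)),
      ih hf hg.deriv, ih hg hf.deriv, Function.iterate_succ_apply, D.leibniz,
      iterate_map_add, map_add, smul_eq_mul, smul_eq_mul]

theorem sum {ι : Type*} {s : Finset ι} {f : ι → ℝ → ℝ} {P : ι → MvPolynomial σ ℝ}
    (h : ∀ i ∈ s, IsJetOf D x (f i) (P i)) :
    IsJetOf D x (fun μ => ∑ i ∈ s, f i μ) (∑ i ∈ s, P i) := by
  classical
  induction s using Finset.induction_on with
  | empty => simpa using const (D := D) (x := x) 0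
  | insert i s hi ih =>
    simp only [Finset.sum_insert hi]
    exact (h i (by simp)).add (ih fun j hj => h j (by simp [hj]))

end IsJetOf

theorem X_four_eq_flowDerivation : (MvPolynomial.X 4 : MvPolynomial ℕ ℝ) =
    MvPolynomial.C (1 / 3) * MvPolynomial.X 2 * (MvPolynomial.X 2 + MvPolynomial.C (-1))
      + MvPolynomial.C (1 / 3) * flowDerivation (MvPolynomial.X 2) := by
  have h : (MvPolynomial.C (1 / 3) * MvPolynomial.C 3 : MvPolynomial ℕ ℝ) = 1 := by
    rw [← map_mul]
    norm_num
  rw [flowDerivation, MvPolynomial.mkDerivation_X, if_pos rfl, map_neg, map_one]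
  linear_combination (-MvPolynomial.X 4) * h

theorem X_add_two_eq_flowDerivation {n : ℕ} (h4 : 4 ≤ n) :
    (MvPolynomial.X (n + 2) : MvPolynomial ℕ ℝ) =
      MvPolynomial.C (1 / ((n : ℝ) + 1)) * pairSumPoly n
        + MvPolynomial.C (1 / ((n : ℝ) + 1)) * MvPolynomial.X n
          * (MvPolynomial.C 2 * MvPolynomial.X 2 + MvPolynomial.C (1 - 4 / (n : ℝ)))
        + MvPolynomial.C (2 / ((n : ℝ) * ((n : ℝ) + 1)))
          * flowDerivation (MvPolynomial.X n) := by
  have hn : (n : ℝ) ≠ 0 := by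
    have : n ≠ 0 := by omega
    exact_mod_cast this
  have h : (MvPolynomial.C (2 / ((n : ℝ) * ((n : ℝ) + 1)))
      * MvPolynomial.C ((n : ℝ) * (n + 1) / 2) : MvPolynomial ℕ ℝ) = 1 := by
    rw [← map_mul, ← map_one MvPolynomial.C]
    congr 1
    have : (n : ℝ) + 1 ≠ 0 := by positivity
    field_simp
  rw [flowDerivation, MvPolynomial.mkDerivation_X, if_neg (by omega), ← mul_assoc, h]
  ring

theorem isJetOf_meanFieldFlow {x : ℕ → ℝ}
    (hf : IsJetOf flowDerivation x f₂ (MvPolynomial.X 2)) {n : ℕ} (hn : Even n) (h2 : 2 ≤ n) :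
    IsJetOf flowDerivation x (meanFieldFlow f₂ n) (MvPolynomial.X n) := by
  refine even_two_le_induction
    (motive := fun n => IsJetOf flowDerivation x (meanFieldFlow f₂ n) (MvPolynomial.X n))
    ?_ ?_ ?_ hn h2
  · rwa [meanFieldFlow_two]
  · rw [meanFieldFlow_four, X_four_eq_flowDerivation]
    exact (((IsJetOf.const _).mul hf).mul (hf.add (.const _))).add ((IsJetOf.const _).mul hf.deriv)
  · intro n hn h4 ih
    have hm := ih n hn (by omega) le_rfl
    have hs : IsJetOf flowDerivation x (mfPairSum (meanFieldFlow f₂) n) (pairSumPoly n) := by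
      refine IsJetOf.sum fun k _ => ?_
      split_ifs with h
      · obtain ⟨hk, h4k, hkn⟩ := h
        exact (ih k hk (by omega) (by omega)).mul (ih _ ((Nat.even_sub (by omega)).2
          (by simp [hk, Nat.even_add, hn])) (by omega) (by omega))
      · simpa using IsJetOf.const 0
    rw [meanFieldFlow_add_two hn h4, X_add_two_eq_flowDerivation h4]
    simp only [add_sub_assoc]
    exact (((IsJetOf.const _).mul hs).add (((IsJetOf.const _).mul hm).mul
      (((IsJetOf.const _).mul hf).add (.const _)))).add ((IsJetOf.const _).mul hm.deriv)

end

/-- existence of smooth solutions of the mean field flow equations with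
pure `φ⁴` boundary data `(φ₂, φ₄, 0, 0, …)`, which vanish together with all derivatives
in the ultraviolet limit `μ_max → ∞`. -/
theorem stmt7 (ε φ₂ φ₄ : ℝ) (hε0 : 0 < ε) (hε : ε ≤ 1 / 100)
    (h2 : |φ₂| ≤ ε / 4) (h4 : 0 ≤ φ₄ ∧ φ₄ ≤ ε / 32) :
    ∃ F : ℝ → ℕ → ℝ → ℝ,
      (∀ μmax > (0 : ℝ), MeanFieldHierarchy μmax (F μmax) ∧
        F μmax 2 0 = φ₂ ∧ F μmax 4 0 = φ₄ ∧
        ∀ n : ℕ, Even n → 6 ≤ n → F μmax n 0 = 0) ∧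
      (∀ n : ℕ, Even n → 2 ≤ n → ∀ l : ℕ,
        Filter.Tendsto (fun μmax => iteratedDeriv l (F μmax n) μmax)
          Filter.atTop (nhds 0)) := by
  let x : ℕ → ℝ := fun n => if n = 2 then φ₂ else if n = 4 then φ₄ else 0
  obtain ⟨f₂, hsmooth, hvanish, hjet⟩ := exists_contDiff_iteratedDeriv_zero_eq
    fun j => MvPolynomial.eval x (flowDerivation^[j] (MvPolynomial.X 2))
  have hzero : ∀ n, Even n → 2 ≤ n → meanFieldFlow f₂ n 0 = x n := fun n hn h2n => by
    simpa using (isJetOf_meanFieldFlow ⟨hsmooth, hjet⟩ hn h2n).apply_zero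
  refine ⟨fun _ => meanFieldFlow f₂, fun μmax _ => ⟨⟨contDiff_meanFieldFlow hsmooth, ?_, ?_⟩,
    ?_, ?_, ?_⟩, ?_⟩
  · intro μ _
    beta_reduce
    rw [meanFieldFlow_four, meanFieldFlow_two]
  · intro n hn h4n μ _
    beta_reduce
    rw [meanFieldFlow_add_two hn h4n, meanFieldFlow_two]
  · simpa [x] using hzero 2 even_two le_rfl
  · simpa [x] using hzero 4 (by decide) (by norm_num)
  · intro n hn h6n
    refine (hzero n hn (by omega)).trans ?_
    simp only [x]
    rw [if_neg (by omega), if_neg (by omega)]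
  · intro n hn h2n l
    refine tendsto_const_nhds.congr' ?_
    filter_upwards [Filter.eventually_gt_atTop 2] with μ hμ
    have hU : Set.EqOn f₂ 0 (Set.Ioi 2) := fun y hy =>
      hvanish y ((Set.mem_Ioi.1 hy).le.trans (le_abs_self y))
    have hev := (meanFieldFlow_eqOn_zero isOpen_Ioi hU hn h2n).eventuallyEq_of_mem
      (Ioi_mem_nhds hμ)
    rw [hev.iteratedDeriv_eq]
    simp
end

section
/- For every integer N ≥ 1, every integer l ≥ 1 and every μ ≥ 0, the function μ ↦ I_N(e^{−μ}) satisfies | (d/dμ)^{l} I_N(e^{−μ}) | ≤ e^{−μ}·2^{N+2l+2}·(l+1)!. -/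
open MeasureTheory

/-- `I_N(γ) = ∫_{[γ,1]^N} (1 + γ₁ + ⋯ + γ_N)^{−2} dγ₁ ⋯ dγ_N`. -/
noncomputable def Ifun (N : ℕ) (γ : ℝ) : ℝ :=
  ∫ x in Set.univ.pi (fun _ : Fin N => Set.Icc γ 1), ((1 + ∑ i, x i) ^ 2)⁻¹

/-- The integral of `(1 + N - s ∑ yᵢ)⁻²` over the unit cube, for complex `s`. -/
noncomputable def cubeIntegral (N : ℕ) (s : ℂ) : ℂ :=
  ∫ y in Set.Icc (0 : Fin N → ℝ) 1, ((1 + N - s * (∑ i, y i : ℝ)) ^ 2)⁻¹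

lemma sum_mem_of_mem_cube {N : ℕ} {y : Fin N → ℝ} (hy : y ∈ Set.Icc (0 : Fin N → ℝ) 1) :
    0 ≤ ∑ i, y i ∧ ∑ i, y i ≤ N := by
  refine ⟨Finset.sum_nonneg fun i _ => hy.1 i, ?_⟩
  calc ∑ i, y i ≤ ∑ _i : Fin N, (1 : ℝ) := Finset.sum_le_sum fun i _ => hy.2 i
    _ = N := by simp

lemma norm_sum_le_of_mem_cube {N : ℕ} {y : Fin N → ℝ} (hy : y ∈ Set.Icc (0 : Fin N → ℝ) 1) :
    ‖((∑ i, y i : ℝ) : ℂ)‖ ≤ N := by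
  rw [Complex.norm_real, Real.norm_of_nonneg (sum_mem_of_mem_cube hy).1]
  exact (sum_mem_of_mem_cube hy).2

lemma one_le_norm_denom {N : ℕ} {y : Fin N → ℝ} (hy : y ∈ Set.Icc (0 : Fin N → ℝ) 1) {s : ℂ}
    (hs : ‖s‖ ≤ 1) : 1 ≤ ‖1 + N - s * (∑ i, y i : ℝ)‖ := by
  have h1 : ‖s * ((∑ i, y i : ℝ) : ℂ)‖ ≤ N := by
    rw [norm_mul]
    nlinarith [norm_sum_le_of_mem_cube hy, norm_nonneg s, norm_nonneg ((∑ i, y i : ℝ) : ℂ)]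
  have h2 : ‖(1 + N : ℂ)‖ = 1 + N := by
    have : (1 + N : ℂ) = ((1 + N : ℝ) : ℂ) := by push_cast; rfl
    rw [this, Complex.norm_real, Real.norm_of_nonneg (by positivity)]
  have h3 := norm_sub_norm_le (1 + N : ℂ) (s * (∑ i, y i : ℝ))
  linarith

lemma denom_ne_zero {N : ℕ} {y : Fin N → ℝ} (hy : y ∈ Set.Icc (0 : Fin N → ℝ) 1) {s : ℂ}
    (hs : ‖s‖ ≤ 1) : 1 + N - s * (∑ i, y i : ℝ) ≠ 0 :=
  norm_pos_iff.1 (zero_lt_one.trans_le (one_le_norm_denom hy hs))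

lemma volume_real_cube (N : ℕ) : volume.real (Set.Icc (0 : Fin N → ℝ) 1) = 1 := by
  rw [Measure.real, Real.volume_Icc_pi_toReal zero_le_one]
  simp

lemma norm_cube_setIntegral_le {N : ℕ} {f : (Fin N → ℝ) → ℂ} {C : ℝ}
    (h : ∀ y ∈ Set.Icc (0 : Fin N → ℝ) 1, ‖f y‖ ≤ C) :
    ‖∫ y in Set.Icc (0 : Fin N → ℝ) 1, f y‖ ≤ C := by
  simpa [volume_real_cube] using
    norm_setIntegral_le_of_norm_le_const (isCompact_Icc.measure_lt_top (μ := volume)) h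

lemma norm_cubeIntegral_le {N : ℕ} {s : ℂ} (hs : ‖s‖ ≤ 1) : ‖cubeIntegral N s‖ ≤ 1 := by
  refine norm_cube_setIntegral_le fun y hy => ?_
  rw [norm_inv, norm_pow]
  exact inv_le_one_of_one_le₀ (one_le_pow₀ (one_le_norm_denom hy hs))

lemma continuousOn_denom_inv {N : ℕ} {s : ℂ} (hs : ‖s‖ ≤ 1) (k : ℕ) :
    ContinuousOn (fun y : Fin N → ℝ => ((1 + N - s * (∑ i, y i : ℝ)) ^ k)⁻¹)
      (Set.Icc (0 : Fin N → ℝ) 1) :=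
  ContinuousOn.inv₀ (by fun_prop) fun _ hy => pow_ne_zero _ (denom_ne_zero hy hs)

lemma norm_deriv_kernel_le {N : ℕ} {y : Fin N → ℝ} (hy : y ∈ Set.Icc (0 : Fin N → ℝ) 1) {s : ℂ}
    (hs : ‖s‖ ≤ 1) :
    ‖2 * ((∑ i, y i : ℝ) : ℂ) * ((1 + N - s * (∑ i, y i : ℝ)) ^ 3)⁻¹‖ ≤ 2 * N := by
  rw [norm_mul, norm_mul, norm_inv, norm_pow, Complex.norm_ofNat]
  have h1 := inv_le_one_of_one_le₀ (one_le_pow₀ (one_le_norm_denom hy hs) (n := 3))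
  calc _ ≤ 2 * ‖((∑ i, y i : ℝ) : ℂ)‖ * 1 := by gcongr
    _ ≤ 2 * N := by linarith [norm_sum_le_of_mem_cube hy]

lemma exists_hasDerivAt_cubeIntegral {N : ℕ} {s : ℂ} (hs : ‖s‖ < 1) :
    ∃ D : ℂ, HasDerivAt (cubeIntegral N) D s ∧ ‖D‖ ≤ 2 * N := by
  have hball : Metric.ball (0 : ℂ) 1 ∈ nhds s :=
    Metric.isOpen_ball.mem_nhds (by simpa using hs)
  have h := hasDerivAt_integral_of_dominated_loc_of_deriv_le
    (μ := volume.restrict (Set.Icc (0 : Fin N → ℝ) 1)) (bound := fun _ => 2 * (N : ℝ))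
    (F := fun (z : ℂ) (y : Fin N → ℝ) => ((1 + N - z * (∑ i, y i : ℝ)) ^ 2)⁻¹)
    (F' := fun (z : ℂ) (y : Fin N → ℝ) =>
      2 * ((∑ i, y i : ℝ) : ℂ) * ((1 + N - z * (∑ i, y i : ℝ)) ^ 3)⁻¹)
    hball ?_ ?_ ?_ ?_ ?_ ?_
  · exact ⟨_, h.2, norm_cube_setIntegral_le fun y hy => norm_deriv_kernel_le hy hs.le⟩
  · filter_upwards [hball] with z hz
    exact (continuousOn_denom_inv (by simpa using (Metric.mem_ball.1 hz).le) 2).aestronglyMeasurable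
      measurableSet_Icc
  · exact (continuousOn_denom_inv hs.le 2).integrableOn_compact isCompact_Icc
  · exact (ContinuousOn.mul (Continuous.continuousOn (by fun_prop))
      (continuousOn_denom_inv hs.le 3)).aestronglyMeasurable measurableSet_Icc
  · refine ae_restrict_of_forall_mem measurableSet_Icc fun y hy z hz => ?_
    exact norm_deriv_kernel_le hy (by simpa using (Metric.mem_ball.1 hz).le)
  · exact integrableOn_const isCompact_Icc.measure_lt_top.ne
  · refine ae_restrict_of_forall_mem measurableSet_Icc fun y hy z hz => ?_
    have hne := denom_ne_zero hy (s := z) (by simpa using (Metric.mem_ball.1 hz).le)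
    have h1 := ((((hasDerivAt_id z).mul_const ((∑ i, y i : ℝ) : ℂ)).const_sub
      (1 + N : ℂ)).pow 2).inv (pow_ne_zero 2 hne)
    refine HasDerivAt.congr_deriv (f := fun x : ℂ => ((1 + N - x * (∑ i, y i : ℝ)) ^ 2)⁻¹) h1 ?_
    simp only [id, Pi.pow_apply]
    field_simp
    push_cast
    ring

lemma exists_hasDerivAt_pow_mul_cubeIntegral {N : ℕ} {s : ℂ} (hs : ‖s‖ < 1) :
    ∃ D : ℂ, HasDerivAt (fun z => z ^ N * cubeIntegral N z) D s ∧ ‖D‖ ≤ 3 * N := by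
  obtain ⟨D, hD, hb⟩ := exists_hasDerivAt_cubeIntegral (N := N) hs
  refine ⟨_, (hasDerivAt_pow N s).mul hD, ?_⟩
  have h1 : ‖s‖ ^ (N - 1) ≤ 1 := pow_le_one₀ (norm_nonneg _) hs.le
  have h2 : ‖s‖ ^ N ≤ 1 := pow_le_one₀ (norm_nonneg _) hs.le
  refine (norm_add_le _ _).trans ?_
  rw [norm_mul, norm_mul, norm_mul, norm_pow, norm_pow, Complex.norm_natCast]
  calc _ ≤ (N : ℝ) * 1 * 1 + 1 * (2 * N) := by
        gcongr
        exact norm_cubeIntegral_le hs.le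
    _ = 3 * N := by ring

/-- The holomorphic extension of `μ ↦ I_N(e^{-μ})`. -/
noncomputable def IfunExt (N : ℕ) (z : ℂ) : ℂ :=
  (1 - Complex.exp (-z)) ^ N * cubeIntegral N (1 - Complex.exp (-z))

lemma exists_hasDerivAt_IfunExt {N : ℕ} {z : ℂ} (hz : ‖1 - Complex.exp (-z)‖ < 1) :
    ∃ D : ℂ, HasDerivAt (IfunExt N) D z ∧ ‖D‖ ≤ 3 * N * ‖Complex.exp (-z)‖ := by
  obtain ⟨D, hD, hb⟩ := exists_hasDerivAt_pow_mul_cubeIntegral (N := N) hz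
  have h1 : HasDerivAt (fun z : ℂ => 1 - Complex.exp (-z)) (Complex.exp (-z)) z := by
    simpa using ((hasDerivAt_neg z).cexp).const_sub 1
  refine ⟨D * Complex.exp (-z), HasDerivAt.comp (h₂ := fun z => z ^ N * cubeIntegral N z) z hD h1, ?_⟩
  rw [norm_mul]
  gcongr

lemma Ifun_eq (N : ℕ) {γ : ℝ} (hγ : γ < 1) :
    Ifun N γ = (1 - γ) ^ N *
      ∫ y in Set.Icc (0 : Fin N → ℝ) 1, ((1 + N - (1 - γ) * ∑ i, y i) ^ 2)⁻¹ := by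
  have hpos : 0 < 1 - γ := sub_pos.2 hγ
  set g : (Fin N → ℝ) → ℝ := (Set.univ.pi (fun _ : Fin N => Set.Icc γ 1)).indicator
    (fun x => ((1 + ∑ i, x i) ^ 2)⁻¹) with hg
  have hI : Ifun N γ = ∫ x, g x :=
    (integral_indicator (MeasurableSet.univ_pi fun _ => measurableSet_Icc)).symm
  have h := Measure.integral_comp_smul volume (fun x => g (1 - x)) (1 - γ)
  rw [integral_sub_left_eq_self g volume 1, ← hI, Module.finrank_fin_fun,
    abs_of_pos (by positivity), smul_eq_mul] at h
  have h2 : ∫ y in Set.Icc (0 : Fin N → ℝ) 1, ((1 + N - (1 - γ) * ∑ i, y i) ^ 2)⁻¹ =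
      ∫ y, g (1 - (1 - γ) • y) := by
    rw [← integral_indicator measurableSet_Icc]
    congr 1
    ext y
    have hmem : y ∈ Set.Icc (0 : Fin N → ℝ) 1 ↔
        1 - (1 - γ) • y ∈ Set.univ.pi (fun _ : Fin N => Set.Icc γ 1) := by
      simp only [Set.mem_Icc, Pi.le_def, Set.mem_univ_pi, ← forall_and]
      refine forall_congr' fun i => ?_
      simp only [Pi.zero_apply, Pi.one_apply, Pi.sub_apply, Pi.smul_apply, smul_eq_mul]
      constructor
      · rintro ⟨h0, h1⟩
        constructor <;> nlinarith
      · rintro ⟨h0, h1⟩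
        constructor <;> by_contra! hc <;> nlinarith
    by_cases hy : y ∈ Set.Icc (0 : Fin N → ℝ) 1
    · rw [Set.indicator_of_mem hy, hg, Set.indicator_of_mem (hmem.1 hy)]
      simp [Finset.mul_sum, add_sub_assoc]
    · rw [Set.indicator_of_notMem hy, hg, Set.indicator_of_notMem (fun h => hy (hmem.2 h))]
  rw [h2, h]
  field_simp

lemma ofReal_Ifun_exp_neg (N : ℕ) {t : ℝ} (ht : 0 < t) :
    (Ifun N (Real.exp (-t)) : ℂ) = IfunExt N t := by
  rw [Ifun_eq N (by simpa using ht), IfunExt, cubeIntegral]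
  push_cast
  rw [← integral_complex_ofReal]
  push_cast
  rfl

lemma norm_one_sub_exp_neg_lt {t : ℝ} (ht : 0 ≤ t) {z : ℂ} (hz : ‖z - t‖ ≤ 1 / 4) :
    ‖1 - Complex.exp (-z)‖ < 1 ∧ ‖Complex.exp (-z)‖ ≤ 3 / 2 * Real.exp (-t) := by
  have hle : Real.exp (-t) ≤ 1 := by simpa using ht
  have hpos := Real.exp_pos (-t)
  have hn : ‖(Real.exp (-t) : ℂ)‖ = Real.exp (-t) := by
    rw [Complex.norm_real, Real.norm_of_nonneg hpos.le]
  have hexp : Complex.exp (-z) = Real.exp (-t) * Complex.exp (t - z) := by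
    rw [Complex.ofReal_exp, ← Complex.exp_add]
    congr 1
    push_cast
    ring
  have hw : ‖(t : ℂ) - z‖ ≤ 1 / 4 := by rwa [norm_sub_rev]
  have h1 : ‖Complex.exp (t - z) - 1‖ ≤ 1 / 2 :=
    (Complex.norm_exp_sub_one_le (by linarith)).trans (by linarith)
  constructor
  · have heq : 1 - Complex.exp (-z) =
        ((1 - Real.exp (-t) : ℝ) : ℂ) - Real.exp (-t) * (Complex.exp (t - z) - 1) := by
      rw [hexp]
      push_cast
      ring
    have hn' : ‖((1 - Real.exp (-t) : ℝ) : ℂ)‖ = 1 - Real.exp (-t) := by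
      rw [Complex.norm_real, Real.norm_of_nonneg (by linarith)]
    have h2 := norm_sub_le ((1 - Real.exp (-t) : ℝ) : ℂ)
      (Real.exp (-t) * (Complex.exp (t - z) - 1))
    rw [norm_mul, hn, hn', ← heq] at h2
    nlinarith
  · have h2 : ‖Complex.exp (t - z)‖ ≤ 3 / 2 := by
      have := norm_sub_norm_le (Complex.exp (t - z)) 1
      rw [norm_one] at this
      linarith
    rw [hexp, norm_mul, hn]
    nlinarith

lemma isOpen_setOf_norm_one_sub_exp_neg_lt : IsOpen {z : ℂ | ‖1 - Complex.exp (-z)‖ < 1} :=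
  isOpen_lt (by fun_prop) continuous_const

lemma differentiableOn_iteratedDeriv_IfunExt (N l : ℕ) :
    DifferentiableOn ℂ (iteratedDeriv l (IfunExt N)) {z : ℂ | ‖1 - Complex.exp (-z)‖ < 1} := by
  induction l with
  | zero =>
    rw [iteratedDeriv_zero]
    intro z hz
    obtain ⟨D, hD, -⟩ := exists_hasDerivAt_IfunExt (N := N) hz
    exact hD.differentiableAt.differentiableWithinAt
  | succ l ih =>
    rw [iteratedDeriv_succ]
    exact ih.deriv isOpen_setOf_norm_one_sub_exp_neg_lt

lemma iteratedDeriv_Ifun_exp_neg (N l : ℕ) {t : ℝ} (ht : 0 < t) :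
    iteratedDeriv l (fun t => Ifun N (Real.exp (-t))) t = (iteratedDeriv l (IfunExt N) t).re := by
  induction l generalizing t with
  | zero => simp [iteratedDeriv_zero, ← ofReal_Ifun_exp_neg N ht]
  | succ l ih =>
    rw [iteratedDeriv_succ, iteratedDeriv_succ]
    have hev : iteratedDeriv l (fun t => Ifun N (Real.exp (-t))) =ᶠ[nhds t]
        fun x : ℝ => (iteratedDeriv l (IfunExt N) x).re := by
      filter_upwards [Ioi_mem_nhds ht] with x hx using ih hx
    have hmem : {z : ℂ | ‖1 - Complex.exp (-z)‖ < 1} ∈ nhds (t : ℂ) :=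
      isOpen_setOf_norm_one_sub_exp_neg_lt.mem_nhds
        (norm_one_sub_exp_neg_lt ht.le (by simp)).1
    rw [hev.deriv_eq]
    exact ((differentiableOn_iteratedDeriv_IfunExt N l).differentiableAt
      hmem).hasDerivAt.real_of_complex.deriv

lemma norm_iteratedDeriv_succ_IfunExt_le (N n : ℕ) {t : ℝ} (ht : 0 ≤ t) :
    ‖iteratedDeriv (n + 1) (IfunExt N) t‖ ≤
      n.factorial * (3 * N * (3 / 2 * Real.exp (-t))) / (1 / 4) ^ n := by
  have hsub : Metric.closedBall (t : ℂ) (1 / 4) ⊆ {z : ℂ | ‖1 - Complex.exp (-z)‖ < 1} :=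
    fun z hz => (norm_one_sub_exp_neg_lt ht (by simpa [dist_eq_norm] using hz)).1
  rw [iteratedDeriv_succ']
  refine Complex.norm_iteratedDeriv_le_of_forall_mem_sphere_norm_le n (by norm_num) ?_ ?_
  · have h := differentiableOn_iteratedDeriv_IfunExt N 1
    rw [iteratedDeriv_one] at h
    exact (h.mono hsub).diffContOnCl_ball subset_rfl
  · intro z hz
    have hz' := norm_one_sub_exp_neg_lt ht (z := z)
      (by rw [← dist_eq_norm, Metric.mem_sphere.1 hz])
    obtain ⟨D, hD, hb⟩ := exists_hasDerivAt_IfunExt (N := N) hz'.1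
    rw [hD.deriv]
    refine hb.trans ?_
    gcongr
    exact hz'.2

lemma iteratedDeriv_eq_zero_of_eqOn_Iio {f : ℝ → ℝ} {a : ℝ} (hf : ∀ t < a, f t = 0) {l : ℕ}
    (hl : 1 ≤ l) : iteratedDeriv l f a = 0 := by
  obtain ⟨n, rfl⟩ := Nat.exists_eq_add_of_le' hl
  rw [iteratedDeriv_succ]
  set g := iteratedDeriv n f
  have hg : ∀ t < a, g t = 0 := fun t ht => by
    have : f =ᶠ[nhds t] fun _ => (0 : ℝ) := by
      filter_upwards [Iio_mem_nhds ht] with x hx using hf x hx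
    simpa using this.iteratedDeriv_eq n
  by_cases hd : DifferentiableAt ℝ g a
  · have hev : g =ᶠ[nhdsWithin a (Set.Iio a)] fun _ => (0 : ℝ) := by
      filter_upwards [self_mem_nhdsWithin] with x hx using hg x hx
    have hga : g a = 0 :=
      tendsto_nhds_unique (hd.continuousAt.tendsto.mono_left nhdsWithin_le_nhds)
        (tendsto_const_nhds.congr' hev.symm)
    refine UniqueDiffWithinAt.eq_deriv _ (uniqueDiffWithinAt_Iic a)
      hd.hasDerivAt.hasDerivWithinAt ?_
    refine (hasDerivWithinAt_const a (Set.Iic a) (0 : ℝ)).congr (fun x hx => ?_) hga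
    rcases (Set.mem_Iic.1 hx).lt_or_eq with h | rfl
    exacts [hg x h, hga]
  · exact deriv_zero_of_not_differentiableAt hd

lemma Ifun_eq_zero_of_one_lt {N : ℕ} (hN : 1 ≤ N) {γ : ℝ} (hγ : 1 < γ) : Ifun N γ = 0 := by
  have : (Set.univ.pi fun _ : Fin N => Set.Icc γ 1) = ∅ :=
    Set.univ_pi_eq_empty_iff.2 ⟨⟨0, hN⟩, Set.Icc_eq_empty (not_le.2 hγ)⟩
  simp [Ifun, this]

/-- derivative bounds for `μ ↦ I_N(e^{−μ})`. -/
theorem stmt11 : ∀ N : ℕ, 1 ≤ N → ∀ l : ℕ, 1 ≤ l → ∀ μ : ℝ, 0 ≤ μ →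
    |iteratedDeriv l (fun t => Ifun N (Real.exp (-t))) μ| ≤
      Real.exp (-μ) * 2 ^ (N + 2 * l + 2) * ((l + 1).factorial : ℝ) := by
  intro N hN l hl μ hμ
  rcases hμ.eq_or_lt with rfl | hμ
  · rw [iteratedDeriv_eq_zero_of_eqOn_Iio
      (fun t ht => Ifun_eq_zero_of_one_lt hN (Real.one_lt_exp_iff.2 (by linarith))) hl, abs_zero]
    positivity
  obtain ⟨n, rfl⟩ := Nat.exists_eq_add_of_le' hl
  rw [iteratedDeriv_Ifun_exp_neg N _ hμ]
  refine (Complex.abs_re_le_norm _).trans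
    ((norm_iteratedDeriv_succ_IfunExt_le N n hμ.le).trans ?_)
  have h1 : (n.factorial : ℝ) ≤ ((n + 1 + 1).factorial : ℝ) := by
    exact_mod_cast Nat.factorial_le (by omega)
  have h2 : (N : ℝ) ≤ 2 ^ N := by exact_mod_cast Nat.lt_two_pow_self.le
  calc (n.factorial : ℝ) * (3 * N * (3 / 2 * Real.exp (-μ))) / (1 / 4) ^ n
      = Real.exp (-μ) * (9 / 2 * N * 4 ^ n) * n.factorial := by
        rw [one_div, inv_pow, div_inv_eq_mul]
        ring
    _ ≤ Real.exp (-μ) * (16 * 2 ^ N * 4 ^ n) * (n + 1 + 1).factorial := by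
        gcongr
        norm_num
    _ = Real.exp (-μ) * 2 ^ (N + 2 * (n + 1) + 2) * (n + 1 + 1).factorial := by
        have : (4 : ℝ) ^ n = 2 ^ (2 * n) := by rw [pow_mul]; norm_num
        rw [this]
        ring
end

section
/- For every integer v ≥ 2 and every even integer n ≥ 2v, the sum over all ordered v-tuples (b₁, …, b_v) of positive even integers with b₁ + ⋯ + b_v = n of the products ∏_{k=1}^{v} 1/((b_k + 2)·(b_k + 1)) is at most (3/2)^{v} / ((n + 2)·(n + 1)). -/
/-- The weight `1/((b+2)(b+1))` of a part `b ≥ 2`, and `0` for smaller parts. -/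
noncomputable def partWeight (b : ℕ) : ℝ :=
  if 2 ≤ b then 1 / (((b : ℝ) + 2) * ((b : ℝ) + 1)) else 0

theorem partWeight_nonneg (b : ℕ) : 0 ≤ partWeight b := by
  unfold partWeight
  split_ifs
  · positivity
  · exact le_rfl

theorem partWeight_le (b : ℕ) : partWeight b ≤ 1 / (((b : ℝ) + 2) * ((b : ℝ) + 1)) := by
  unfold partWeight
  split_ifs
  · exact le_rfl
  · positivity

theorem sum_range_add_two_partWeight (m : ℕ) :
    ∑ i ∈ Finset.range (m + 2), partWeight i = 1 / 3 - 1 / ((m : ℝ) + 3) := by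
  induction m with
  | zero => norm_num [Finset.sum_range_succ, partWeight]
  | succ m ih =>
    rw [show m + 1 + 2 = (m + 2) + 1 by ring, Finset.sum_range_succ, ih, partWeight,
      if_pos (by omega)]
    push_cast
    field_simp
    ring

theorem sum_range_partWeight_le (n : ℕ) : ∑ i ∈ Finset.range n, partWeight i ≤ 1 / 3 := by
  calc ∑ i ∈ Finset.range n, partWeight i ≤ ∑ i ∈ Finset.range (n + 2), partWeight i :=
        Finset.sum_le_sum_of_subset_of_nonneg (Finset.range_mono (by omega))
          fun i _ _ => partWeight_nonneg i
    _ = 1 / 3 - 1 / ((n : ℝ) + 3) := sum_range_add_two_partWeight n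
    _ ≤ 1 / 3 := sub_le_self _ (by positivity)

theorem partWeight_mul_le (i j : ℕ) :
    partWeight i * partWeight j ≤ 2 * partWeight (i + j) * (partWeight i + partWeight j) := by
  by_cases h : 2 ≤ i ∧ 2 ≤ j
  · obtain ⟨hi, hj⟩ := h
    rw [partWeight, partWeight, partWeight, if_pos hi, if_pos hj, if_pos (by omega)]
    push_cast
    have hx : (0 : ℝ) ≤ i := i.cast_nonneg
    have hy : (0 : ℝ) ≤ j := j.cast_nonneg
    generalize (i : ℝ) = x at *
    generalize (j : ℝ) = y at *
    rw [div_mul_div_comm, div_add_div _ _ (by positivity) (by positivity), mul_one_div,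
      div_mul_div_comm, div_le_div_iff₀ (by positivity) (by positivity)]
    have key : (x + y + 2) * (x + y + 1) ≤
        2 * ((y + 2) * (y + 1) + (x + 2) * (x + 1)) := by
      nlinarith [sq_nonneg (x - y)]
    have hpos : 0 ≤ (x + 2) * (x + 1) * ((y + 2) * (y + 1)) := by positivity
    nlinarith [mul_le_mul_of_nonneg_left key hpos]
  · have h0 : partWeight i * partWeight j = 0 := by
      rcases not_and_or.mp h with h | h <;> simp [partWeight, h]
    rw [h0]
    have := partWeight_nonneg i
    have := partWeight_nonneg j
    have := partWeight_nonneg (i + j)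
    positivity

theorem sum_antidiagonal_partWeight_mul_le (n : ℕ) :
    ∑ p ∈ Finset.HasAntidiagonal.antidiagonal n, partWeight p.1 * partWeight p.2 ≤ 3 / 2 * partWeight n := by
  have hfst : ∑ p ∈ Finset.HasAntidiagonal.antidiagonal n, partWeight p.1 ≤ 1 / 3 := by
    rw [Finset.Nat.sum_antidiagonal_eq_sum_range_succ_mk]
    exact sum_range_partWeight_le _
  have hsnd : ∑ p ∈ Finset.HasAntidiagonal.antidiagonal n, partWeight p.2 ≤ 1 / 3 := by
    rw [← Finset.Nat.sum_antidiagonal_swap]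
    exact hfst
  calc ∑ p ∈ Finset.HasAntidiagonal.antidiagonal n, partWeight p.1 * partWeight p.2
      ≤ ∑ p ∈ Finset.HasAntidiagonal.antidiagonal n, 2 * partWeight n * (partWeight p.1 + partWeight p.2) := by
        refine Finset.sum_le_sum fun p hp => ?_
        rw [← Finset.HasAntidiagonal.mem_antidiagonal.mp hp]
        exact partWeight_mul_le _ _
    _ = 2 * partWeight n * (∑ p ∈ Finset.HasAntidiagonal.antidiagonal n, partWeight p.1
          + ∑ p ∈ Finset.HasAntidiagonal.antidiagonal n, partWeight p.2) := by
        rw [← Finset.mul_sum, Finset.sum_add_distrib]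
    _ ≤ 3 / 2 * partWeight n := by nlinarith [partWeight_nonneg n]

theorem sum_antidiagonalTuple_succ {M : Type*} [AddCommMonoid M] (v n : ℕ)
    (f : (Fin (v + 1) → ℕ) → M) :
    ∑ b ∈ Finset.Nat.antidiagonalTuple (v + 1) n, f b =
      ∑ p ∈ Finset.HasAntidiagonal.antidiagonal n, ∑ c ∈ Finset.Nat.antidiagonalTuple v p.2,
        f (Fin.cons p.1 c) := by
  rw [Finset.sum_sigma']
  refine Finset.sum_bij' (fun b _ => ⟨(b 0, ∑ i, Fin.tail b i), Fin.tail b⟩)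
    (fun x _ => Fin.cons x.1.1 x.2) ?_ ?_ ?_ ?_ ?_
  · intro b hb
    rw [Finset.Nat.mem_antidiagonalTuple, Fin.sum_univ_succ] at hb
    simpa [Finset.Nat.mem_antidiagonalTuple, Fin.tail] using hb
  · rintro ⟨⟨i, j⟩, c⟩ hx
    simp only [Finset.mem_sigma, Finset.HasAntidiagonal.mem_antidiagonal, Finset.Nat.mem_antidiagonalTuple] at hx
    simp [Finset.Nat.mem_antidiagonalTuple, Fin.sum_univ_succ, hx.1, hx.2]
  · simp
  · rintro ⟨⟨i, j⟩, c⟩ hx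
    simp only [Finset.mem_sigma, Finset.Nat.mem_antidiagonalTuple] at hx
    simp [hx.2]
  · simp

theorem sum_antidiagonalTuple_prod_partWeight_le (v n : ℕ) :
    ∑ b ∈ Finset.Nat.antidiagonalTuple (v + 1) n, ∏ k, partWeight (b k)
      ≤ (3 / 2) ^ v * partWeight n := by
  induction v generalizing n with
  | zero => simp
  | succ v ih =>
    calc ∑ b ∈ Finset.Nat.antidiagonalTuple (v + 1 + 1) n, ∏ k, partWeight (b k)
        = ∑ p ∈ Finset.HasAntidiagonal.antidiagonal n, partWeight p.1 *
            ∑ c ∈ Finset.Nat.antidiagonalTuple (v + 1) p.2, ∏ k, partWeight (c k) := by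
          rw [sum_antidiagonalTuple_succ]
          simp_rw [Fin.prod_univ_succ (n := v + 1), Fin.cons_zero, Fin.cons_succ, Finset.mul_sum]
      _ ≤ ∑ p ∈ Finset.HasAntidiagonal.antidiagonal n, partWeight p.1 * ((3 / 2) ^ v * partWeight p.2) :=
          Finset.sum_le_sum fun p _ => mul_le_mul_of_nonneg_left (ih p.2) (partWeight_nonneg _)
      _ = (3 / 2) ^ v * ∑ p ∈ Finset.HasAntidiagonal.antidiagonal n, partWeight p.1 * partWeight p.2 := by
          rw [Finset.mul_sum]
          exact Finset.sum_congr rfl fun p _ => by ring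
      _ ≤ (3 / 2) ^ v * (3 / 2 * partWeight n) :=
          mul_le_mul_of_nonneg_left (sum_antidiagonal_partWeight_mul_le n) (by positivity)
      _ = (3 / 2) ^ (v + 1) * partWeight n := by ring

/-- for `v ≥ 2` and even `n ≥ 2v`, the sum over ordered `v`-tuples of
positive even integers `(b₁,…,b_v)` with `b₁+⋯+b_v = n` of `∏_k 1/((b_k+2)(b_k+1))`
is at most `(3/2)^v/((n+2)(n+1))`. -/
theorem stmt14 : ∀ v : ℕ, 2 ≤ v → ∀ n : ℕ, Even n → 2 * v ≤ n →
    (∑ b ∈ Finset.Nat.antidiagonalTuple v n,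
        if ∀ k, Even (b k) ∧ 0 < b k then
          ∏ k, (1 : ℝ) / (((b k : ℝ) + 2) * ((b k : ℝ) + 1))
        else 0)
      ≤ (3 / 2) ^ v / (((n : ℝ) + 2) * ((n : ℝ) + 1)) := by
  intro v hv n _ _
  obtain ⟨v, rfl⟩ := Nat.exists_eq_add_of_le' (show 1 ≤ v by omega)
  calc _ ≤ ∑ b ∈ Finset.Nat.antidiagonalTuple (v + 1) n, ∏ k, partWeight (b k) := by
        refine Finset.sum_le_sum fun b _ => ?_
        split_ifs with hb
        · refine (Finset.prod_congr rfl fun k _ => ?_).le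
          obtain ⟨⟨r, hr⟩, hk⟩ := hb k
          rw [partWeight, if_pos (by omega)]
        · exact Finset.prod_nonneg fun k _ => partWeight_nonneg _
    _ ≤ (3 / 2) ^ v * partWeight n := sum_antidiagonalTuple_prod_partWeight_le v n
    _ ≤ (3 / 2) ^ (v + 1) * (1 / (((n : ℝ) + 2) * ((n : ℝ) + 1))) :=
        mul_le_mul (pow_le_pow_right₀ (by norm_num) v.le_succ) (partWeight_le n)
          (partWeight_nonneg n) (by positivity)
    _ = _ := mul_one_div _ _
end

section
/- Let (a_n)_{n ≥ 1} be a real sequence with |a_n| ≤ C·r^{n} for some C > 0 and 0 < r < 1, and define f₂(μ) := Σ_{n ≥ 1} a_n·(nμ)^{n−1}/(1 + (nμ)^{n}) for μ ≥ 0. Then f₂ is a smooth function on [0, ∞), and its Taylor coefficients at μ = 0 are given by f₂^{(k)}(0)/k! = (k+1)^{k}·Σ_{ρ=1}^{k+1} a_{{(k+1)/ρ}}·(−1)^{ρ−1}·ρ^{−k} for every integer k ≥ 0, where a_{{m}} := a_m if m is a positive integer and a_{{m}} := 0 if (k+1)/ρ is not an integer. -/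
/-- The series `f₂(μ) = Σ_{n ≥ 1} a_n·(nμ)^{n−1}/(1 + (nμ)^n)` (the summation index
below is shifted, the term of index `n : ℕ` corresponding to `n+1 ≥ 1`). -/
noncomputable def f2series (a : ℕ → ℝ) (μ : ℝ) : ℝ :=
  ∑' n : ℕ, a (n + 1) * (((n : ℝ) + 1) * μ) ^ n / (1 + (((n : ℝ) + 1) * μ) ^ (n + 1))

open Set Filter Topology

/-- A tower of successive derivatives within `[0, ∞)` computes the iterated derivatives. -/
lemma iteratedDerivWithin_Ici_eq_of_tower {F : ℕ → ℝ → ℝ}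
    (hF : ∀ k, ∀ x ∈ Ici (0 : ℝ), HasDerivWithinAt (F k) (F (k + 1) x) (Ici 0) x) (k : ℕ) :
    ∀ x ∈ Ici (0 : ℝ), iteratedDerivWithin k (F 0) (Ici 0) x = F k x := by
  induction k with
  | zero => intro x _; simp
  | succ k ih =>
    intro x hx
    rw [iteratedDerivWithin_succ, derivWithin_congr ih (ih x hx)]
    exact (hF k x hx).derivWithin (uniqueDiffOn_Ici 0 x hx)

lemma contDiffOn_Ici_of_tower {F : ℕ → ℝ → ℝ}
    (hF : ∀ k, ∀ x ∈ Ici (0 : ℝ), HasDerivWithinAt (F k) (F (k + 1) x) (Ici 0) x) :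
    ContDiffOn ℝ (⊤ : ℕ∞) (F 0) (Ici 0) := by
  refine contDiffOn_of_differentiableOn_deriv fun m _ => ?_
  have h : DifferentiableOn ℝ (F m) (Ici 0) := fun x hx => (hF m x hx).differentiableWithinAt
  exact h.congr (iteratedDerivWithin_Ici_eq_of_tower hF m)

/-- Termwise differentiation on `[0, ∞)`, including the endpoint. -/
lemma hasDerivWithinAt_tsum_Ici {g g' : ℕ → ℝ → ℝ} {u v : ℕ → ℝ}
    (hu : Summable u) (hv : Summable v)
    (hg : ∀ n, ∀ x ∈ Ici (0 : ℝ), HasDerivAt (g n) (g' n x) x)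
    (hg' : ∀ n, ContinuousOn (g' n) (Ici 0))
    (hgu : ∀ n, ∀ x ∈ Ici (0 : ℝ), ‖g n x‖ ≤ u n)
    (hgv : ∀ n, ∀ x ∈ Ici (0 : ℝ), ‖g' n x‖ ≤ v n) :
    ∀ x ∈ Ici (0 : ℝ),
      HasDerivWithinAt (fun y => ∑' n, g n y) (∑' n, g' n x) (Ici 0) x := by
  have hint : ∀ x ∈ Ioi (0 : ℝ), HasDerivAt (fun y => ∑' n, g n y) (∑' n, g' n x) x := by
    intro x hx
    have hs : Summable fun n => g n x :=
      Summable.of_norm_bounded hu fun n => hgu n x (Ioi_subset_Ici_self hx)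
    exact hasDerivAt_tsum_of_isPreconnected hv isOpen_Ioi isPreconnected_Ioi
      (fun n y hy => hg n y (Ioi_subset_Ici_self hy))
      (fun n y hy => hgv n y (Ioi_subset_Ici_self hy)) hx hs hx
  have hc : ContinuousOn (fun y => ∑' n, g n y) (Ici 0) :=
    continuousOn_tsum (fun n x hx => (hg n x hx).continuousAt.continuousWithinAt) hu hgu
  have hc' : ContinuousOn (fun y => ∑' n, g' n y) (Ici 0) := continuousOn_tsum hg' hv hgv
  intro x hx
  rcases eq_or_lt_of_le (mem_Ici.1 hx) with rfl | hx0
  · refine hasDerivWithinAt_Ici_of_tendsto_deriv (s := Ioi 0)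
      (fun y hy => (hint y hy).differentiableAt.differentiableWithinAt)
      ((hc 0 hx).mono Ioi_subset_Ici_self) self_mem_nhdsWithin ?_
    refine ((hc' 0 hx).mono Ioi_subset_Ici_self).tendsto.congr' ?_
    filter_upwards [self_mem_nhdsWithin] with y hy
    exact (hint y hy).deriv.symm
  · exact (hint x hx0).hasDerivWithinAt

lemma one_add_pow_pos {n : ℕ} (hn : n ≠ 0) {x : ℝ} (hx : -1 < x) : 0 < 1 + x ^ n := by
  rcases le_or_gt 0 x with h | h
  · positivity
  · have : |x ^ n| < 1 := by
      rw [abs_pow]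
      exact pow_lt_one₀ (abs_nonneg x) (abs_lt.2 ⟨hx, by linarith⟩) hn
    linarith [(abs_lt.1 this).1]

lemma contDiffAt_pow_div_one_add_pow {n : ℕ} (hn : n ≠ 0) (i j : ℕ) {x : ℝ} (hx : -1 < x)
    {m : WithTop ℕ∞} : ContDiffAt ℝ m (fun y : ℝ => y ^ i / (1 + y ^ n) ^ j) x :=
  ContDiffAt.div (by fun_prop) (by fun_prop) (pow_pos (one_add_pow_pos hn hx) j).ne'

lemma deriv_pow_div_one_add_pow {n : ℕ} (hn : n ≠ 0) (i j : ℕ) {x : ℝ} (hx : -1 < x) :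
    deriv (fun y : ℝ => y ^ i / (1 + y ^ n) ^ j) x =
      i * (x ^ (i - 1) / (1 + x ^ n) ^ j) -
        (j * n) * (x ^ (i + n - 1) / (1 + x ^ n) ^ (j + 1)) := by
  have hp := one_add_pow_pos hn hx
  have h := (hasDerivAt_pow i x).div (((hasDerivAt_pow n x).const_add 1).pow j)
    (pow_pos hp j).ne'
  refine h.deriv.trans ?_
  obtain ⟨n, rfl⟩ := Nat.exists_eq_succ_of_ne_zero hn
  rcases j with _ | j
  · simp
  · simp only [Nat.succ_eq_add_one, Nat.add_sub_cancel, ← add_assoc] at hp ⊢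
    simp only [Pi.pow_apply]
    field_simp
    ring

/-- The iterated derivatives of `y ^ i / (1 + y ^ n) ^ j` grow at most polynomially in `n`,
uniformly on `[0, ∞)`. -/
lemma abs_iteratedDeriv_pow_div_one_add_pow_le {n : ℕ} (hn : n ≠ 0) (k : ℕ) :
    ∀ i j : ℕ, i ≤ n * j → ∀ x : ℝ, 0 ≤ x →
      |iteratedDeriv k (fun y : ℝ => y ^ i / (1 + y ^ n) ^ j) x| ≤ (2 * n * (j + k)) ^ k := by
  induction k with
  | zero =>
    intro i j hij x hx
    have hp : 0 < 1 + x ^ n := by positivity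
    rw [iteratedDeriv_zero, abs_of_nonneg (by positivity), pow_zero, div_le_one (by positivity)]
    rcases le_or_gt x 1 with h | h
    · exact (pow_le_one₀ hx h).trans (one_le_pow₀ (by linarith [pow_nonneg hx n]))
    · calc x ^ i ≤ x ^ (n * j) := pow_le_pow_right₀ h.le hij
        _ = (x ^ n) ^ j := pow_mul _ _ _
        _ ≤ _ := by gcongr; linarith
  | succ k ih =>
    intro i j hij x hx
    have hev : deriv (fun y : ℝ => y ^ i / (1 + y ^ n) ^ j) =ᶠ[𝓝 x]
        (fun y : ℝ => (i : ℝ) * (y ^ (i - 1) / (1 + y ^ n) ^ j)) -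
          (fun y : ℝ => ((j : ℝ) * n) * (y ^ (i + n - 1) / (1 + y ^ n) ^ (j + 1))) := by
      filter_upwards [Ioi_mem_nhds (show -1 < x by linarith)] with y hy
      exact deriv_pow_div_one_add_pow hn i j hy
    have hx1 : -1 < x := by linarith
    rw [iteratedDeriv_succ', hev.iteratedDeriv_eq,
      iteratedDeriv_sub (contDiffAt_const.mul (contDiffAt_pow_div_one_add_pow hn _ _ hx1))
        (contDiffAt_const.mul (contDiffAt_pow_div_one_add_pow hn _ _ hx1)),
      iteratedDeriv_const_mul_field, iteratedDeriv_const_mul_field]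
    have h1 := ih (i - 1) j (by omega) x hx
    have h2 := ih (i + n - 1) (j + 1) (by rw [mul_add]; omega) x hx
    have hi : (i : ℝ) ≤ n * j := by exact_mod_cast hij
    refine (abs_sub _ _).trans ?_
    rw [abs_mul, abs_mul, Nat.abs_cast, abs_of_nonneg (by positivity : (0 : ℝ) ≤ j * n)]
    push_cast at h2 ⊢
    calc _ ≤ (n * j) * (2 * n * (j + (k + 1)) : ℝ) ^ k
          + (j * n) * (2 * n * (j + (k + 1)) : ℝ) ^ k := by
          gcongr
          · refine h1.trans ?_
            gcongr
            linarith
          · refine h2.trans (le_of_eq ?_)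
            ring
      _ = (2 * n * (j + (k + 1)) : ℝ) ^ k * (2 * n * j) := by ring
      _ ≤ (2 * n * (j + (k + 1)) : ℝ) ^ k * (2 * n * (j + (k + 1))) := by
          gcongr
          linarith [(k.cast_nonneg : (0 : ℝ) ≤ k)]
      _ = _ := (pow_succ _ _).symm

lemma iteratedDeriv_pow_zero (m k : ℕ) :
    iteratedDeriv k (fun x : ℝ => x ^ m) 0 = if m = k then (k.factorial : ℝ) else 0 := by
  rw [iteratedDeriv_pow]
  rcases lt_trichotomy m k with h | rfl | h
  · simp [Nat.descFactorial_of_lt h, h.ne]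
  · simp [Nat.descFactorial_self]
  · simp [h.ne', Nat.sub_ne_zero_of_lt h]

lemma iteratedDeriv_pow_mul_zero {m k : ℕ} (h : k < m) {g : ℝ → ℝ} (hg : ContDiffAt ℝ k g 0) :
    iteratedDeriv k (fun x : ℝ => x ^ m * g x) 0 = 0 := by
  rw [iteratedDeriv_fun_mul (by fun_prop) hg]
  refine Finset.sum_eq_zero fun i hi => ?_
  have : m ≠ i := by have := Finset.mem_range.1 hi; omega
  rw [iteratedDeriv_pow_zero, if_neg this]
  simp

/-- The Taylor coefficients of `x ^ (n - 1) / (1 + x ^ n)` at `0`, with `n = m + 1`. -/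
lemma iteratedDeriv_pow_div_one_add_pow_zero (m k : ℕ) :
    iteratedDeriv k (fun x : ℝ => x ^ m / (1 + x ^ (m + 1)) ^ 1) 0 =
      if m + 1 ∣ k + 1 then (-1) ^ ((k + 1) / (m + 1) - 1) * (k.factorial : ℝ) else 0 := by
  have hm : m + 1 ≠ 0 := m.succ_ne_zero
  have hev : (fun x : ℝ => x ^ m / (1 + x ^ (m + 1)) ^ 1) =ᶠ[𝓝 0]
      (fun x => ∑ j ∈ Finset.range (k + 1), (-1) ^ j * x ^ ((m + 1) * j + m)) +
        (fun x => x ^ ((m + 1) * (k + 1)) *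
          ((-1) ^ (k + 1) * (x ^ m / (1 + x ^ (m + 1)) ^ 1))) := by
    filter_upwards [Ioi_mem_nhds (show (-1 : ℝ) < 0 by norm_num)] with x hx
    have hp := one_add_pow_pos hm hx
    have hgeom := mul_neg_geom_sum (-x ^ (m + 1)) (k + 1)
    have hsum : ∑ j ∈ Finset.range (k + 1), (-1 : ℝ) ^ j * x ^ ((m + 1) * j + m) =
        x ^ m * ∑ j ∈ Finset.range (k + 1), (-x ^ (m + 1)) ^ j := by
      rw [Finset.mul_sum]
      refine Finset.sum_congr rfl fun j _ => ?_
      rw [neg_pow (x ^ (m + 1)), pow_add, pow_mul]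
      ring
    have hpow : x ^ ((m + 1) * (k + 1)) * (-1) ^ (k + 1) = (-x ^ (m + 1)) ^ (k + 1) := by
      rw [neg_pow (x ^ (m + 1)), pow_mul]
      ring
    rw [Pi.add_apply, hsum, ← mul_assoc, hpow, pow_one]
    rw [sub_neg_eq_add] at hgeom
    field_simp
    linear_combination (-x ^ m) * hgeom
  have hsmooth : ContDiffAt ℝ k
      (fun x : ℝ => (-1) ^ (k + 1) * (x ^ m / (1 + x ^ (m + 1)) ^ 1)) 0 :=
    contDiffAt_const.mul (contDiffAt_pow_div_one_add_pow hm _ _ (by norm_num))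
  have hk : k < (m + 1) * (k + 1) := by nlinarith
  rw [hev.iteratedDeriv_eq, iteratedDeriv_add (by fun_prop)
    (ContDiffAt.mul (by fun_prop) hsmooth), iteratedDeriv_pow_mul_zero hk hsmooth, add_zero,
    iteratedDeriv_fun_sum (fun j _ => by fun_prop)]
  simp only [iteratedDeriv_const_mul_field, iteratedDeriv_pow_zero]
  split_ifs with hdvd
  · obtain ⟨q, hq⟩ := hdvd
    obtain ⟨j, rfl⟩ : ∃ j, q = j + 1 := Nat.exists_eq_succ_of_ne_zero (by rintro rfl; omega)
    have hj : (m + 1) * j + m = k := by rw [mul_add] at hq; omega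
    rw [hq, Nat.mul_div_cancel_left _ m.succ_pos, Nat.add_sub_cancel,
      Finset.sum_eq_single j]
    · rw [if_pos hj]
    · intro b _ hb
      rw [if_neg, mul_zero]
      intro h
      exact hb (Nat.eq_of_mul_eq_mul_left m.succ_pos (Nat.add_right_cancel (h.trans hj.symm)))
    · intro h
      exact absurd (Finset.mem_range.2 (by nlinarith)) h
  · refine Finset.sum_eq_zero fun j _ => ?_
    rw [if_neg, mul_zero]
    intro h
    exact hdvd ⟨j + 1, by rw [mul_add]; omega⟩

/-- The `k`-th derivative of the summand of `f2series` with index `n`. -/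
noncomputable def f2seriesTerm (a : ℕ → ℝ) (k n : ℕ) (μ : ℝ) : ℝ :=
  a (n + 1) * ((n : ℝ) + 1) ^ k *
    iteratedDeriv k (fun x : ℝ => x ^ n / (1 + x ^ (n + 1)) ^ 1) (((n : ℝ) + 1) * μ)

lemma hasDerivAt_f2seriesTerm (a : ℕ → ℝ) (k n : ℕ) {μ : ℝ} (hμ : 0 ≤ μ) :
    HasDerivAt (f2seriesTerm a k n) (f2seriesTerm a (k + 1) n μ) μ := by
  have hx : -1 < ((n : ℝ) + 1) * μ := by
    have : 0 ≤ ((n : ℝ) + 1) * μ := by positivity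
    linarith
  have hsm : ContDiffAt ℝ (⊤ : ℕ∞) (fun x : ℝ => x ^ n / (1 + x ^ (n + 1)) ^ 1)
      (((n : ℝ) + 1) * μ) := contDiffAt_pow_div_one_add_pow n.succ_ne_zero _ _ hx
  have hd : DifferentiableAt ℝ (iteratedDeriv k fun x : ℝ => x ^ n / (1 + x ^ (n + 1)) ^ 1)
      (((n : ℝ) + 1) * μ) := by
    have := ContDiffWithinAt.differentiableWithinAt_iteratedDerivWithin (m := k)
      (contDiffWithinAt_univ.2 hsm) (by exact_mod_cast ENat.natCast_lt_top k)
      (by simp)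
    rwa [iteratedDerivWithin_univ, differentiableWithinAt_univ] at this
  have hd' := hd.hasDerivAt
  rw [← iteratedDeriv_succ] at hd'
  have hlin : HasDerivAt (fun y : ℝ => ((n : ℝ) + 1) * y) ((n : ℝ) + 1) μ := by
    simpa using (hasDerivAt_id μ).const_mul ((n : ℝ) + 1)
  refine ((hd'.comp μ hlin).const_mul (a (n + 1) * ((n : ℝ) + 1) ^ k)).congr_deriv ?_
  rw [f2seriesTerm, pow_succ]
  ring

lemma norm_f2seriesTerm_le {a : ℕ → ℝ} {C r : ℝ} (ha : ∀ n : ℕ, 1 ≤ n → |a n| ≤ C * r ^ n)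
    (k n : ℕ) {μ : ℝ} (hμ : 0 ≤ μ) :
    ‖f2seriesTerm a k n μ‖ ≤
      C * (2 * (1 + k)) ^ k * (((n + 1 : ℕ) : ℝ) ^ (2 * k) * r ^ (n + 1)) := by
  have h := abs_iteratedDeriv_pow_div_one_add_pow_le n.succ_ne_zero k n 1 (by simp)
    (((n : ℝ) + 1) * μ) (by positivity)
  have ha' := ha (n + 1) (by simp)
  have hC := (abs_nonneg _).trans ha'
  rw [Real.norm_eq_abs, f2seriesTerm, abs_mul, abs_mul,
    abs_of_nonneg (by positivity : (0 : ℝ) ≤ ((n : ℝ) + 1) ^ k)]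
  calc _ ≤ C * r ^ (n + 1) * ((n : ℝ) + 1) ^ k * (2 * (n + 1 : ℕ) * ((1 : ℕ) + k)) ^ k := by
        gcongr
    _ = _ := by
        push_cast
        rw [mul_pow, mul_pow, mul_pow, two_mul k, pow_add _ k k]
        ring

lemma summable_f2seriesTerm_bound (C : ℝ) {r : ℝ} (hr0 : 0 < r) (hr1 : r < 1) (k : ℕ) :
    Summable fun n : ℕ =>
      C * (2 * (1 + k)) ^ k * (((n + 1 : ℕ) : ℝ) ^ (2 * k) * r ^ (n + 1)) := by
  have h : Summable fun n : ℕ => (n : ℝ) ^ (2 * k) * r ^ n :=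
    summable_pow_mul_geometric_of_norm_lt_one _ (by rwa [Real.norm_eq_abs, abs_of_pos hr0])
  exact ((summable_nat_add_iff 1).2 h).mul_left _

lemma hasDerivWithinAt_tsum_f2seriesTerm {a : ℕ → ℝ} {C r : ℝ} (hr0 : 0 < r) (hr1 : r < 1)
    (ha : ∀ n : ℕ, 1 ≤ n → |a n| ≤ C * r ^ n) (k : ℕ) :
    ∀ μ ∈ Ici (0 : ℝ), HasDerivWithinAt (fun x => ∑' n, f2seriesTerm a k n x)
      (∑' n, f2seriesTerm a (k + 1) n μ) (Ici 0) μ :=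
  hasDerivWithinAt_tsum_Ici (summable_f2seriesTerm_bound C hr0 hr1 k)
    (summable_f2seriesTerm_bound C hr0 hr1 (k + 1))
    (fun n _ hx => hasDerivAt_f2seriesTerm a k n hx)
    (fun n _ hx => (hasDerivAt_f2seriesTerm a (k + 1) n hx).continuousAt.continuousWithinAt)
    (fun n _ hx => norm_f2seriesTerm_le ha k n hx)
    (fun n _ hx => norm_f2seriesTerm_le ha (k + 1) n hx)

lemma f2series_eq_tsum_f2seriesTerm (a : ℕ → ℝ) :
    f2series a = fun μ => ∑' n, f2seriesTerm a 0 n μ := by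
  funext μ
  refine tsum_congr fun n => ?_
  simp [f2seriesTerm, mul_div_assoc]

lemma Nat.filter_dvd_Icc_eq_divisors (N : ℕ) : {d ∈ Finset.Icc 1 N | d ∣ N} = N.divisors := by
  ext d
  simp only [Finset.mem_filter, Finset.mem_Icc, Nat.mem_divisors]
  constructor
  · rintro ⟨⟨h1, h2⟩, h⟩
    exact ⟨h, by omega⟩
  · rintro ⟨h, h0⟩
    exact ⟨⟨Nat.pos_of_dvd_of_pos h (Nat.pos_of_ne_zero h0),
      Nat.le_of_dvd (Nat.pos_of_ne_zero h0) h⟩, h⟩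

lemma tsum_f2seriesTerm_zero (a : ℕ → ℝ) (k : ℕ) :
    ∑' n, f2seriesTerm a k n 0 = (k.factorial : ℝ) *
      ∑ d ∈ (k + 1).divisors, a d * (d : ℝ) ^ k * (-1) ^ ((k + 1) / d - 1) := by
  have hterm : ∀ n, f2seriesTerm a k n 0 = if n + 1 ∣ k + 1 then
      (k.factorial : ℝ) * (a (n + 1) * ((n + 1 : ℕ) : ℝ) ^ k * (-1) ^ ((k + 1) / (n + 1) - 1))
      else 0 := by
    intro n
    rw [f2seriesTerm, mul_zero, iteratedDeriv_pow_div_one_add_pow_zero]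
    split_ifs
    · push_cast
      ring
    · simp
  rw [tsum_congr hterm, tsum_eq_sum (s := Finset.range (k + 1)), Finset.mul_sum,
    ← Nat.filter_dvd_Icc_eq_divisors, Finset.sum_filter, ← Finset.Ico_add_one_right_eq_Icc,
    Finset.sum_Ico_eq_sum_range]
  · simp only [Nat.add_sub_cancel, add_comm 1]
  · intro n hn
    rw [if_neg]
    intro h
    exact hn (Finset.mem_range.2 (Nat.le_of_dvd k.succ_pos h))

/-- under a geometric bound `|a_n| ≤ C·r^n`, `0 < r < 1`, the series
`f₂` is smooth on `[0, ∞)` and its Taylor coefficients at `0` are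
`f₂^{(k)}(0)/k! = (k+1)^k Σ_{ρ=1}^{k+1} a_{{(k+1)/ρ}}·(−1)^{ρ−1}·ρ^{−k}`, where only
divisors `ρ` of `k+1` contribute. -/
theorem stmt18 (a : ℕ → ℝ) (C r : ℝ) (hC : 0 < C) (hr0 : 0 < r) (hr1 : r < 1)
    (ha : ∀ n : ℕ, 1 ≤ n → |a n| ≤ C * r ^ n) :
    ContDiffOn ℝ (⊤ : ℕ∞) (f2series a) (Set.Ici 0) ∧
    ∀ k : ℕ,
      iteratedDerivWithin k (f2series a) (Set.Ici 0) 0 / (k.factorial : ℝ) =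
        ((k : ℝ) + 1) ^ k * ∑ ρ ∈ Finset.Icc 1 (k + 1),
          (if ρ ∣ (k + 1) then a ((k + 1) / ρ) else 0) * (-1 : ℝ) ^ (ρ - 1) *
            (1 / (ρ : ℝ)) ^ k := by
  have htower := hasDerivWithinAt_tsum_f2seriesTerm hr0 hr1 ha
  rw [f2series_eq_tsum_f2seriesTerm]
  refine ⟨contDiffOn_Ici_of_tower (F := fun k μ => ∑' n, f2seriesTerm a k n μ) htower,
    fun k => ?_⟩
  rw [iteratedDerivWithin_Ici_eq_of_tower (F := fun k μ => ∑' n, f2seriesTerm a k n μ) htower k 0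
    self_mem_Ici, tsum_f2seriesTerm_zero, mul_div_cancel_left₀ _ (by positivity)]
  simp only [ite_mul, zero_mul]
  rw [← Finset.sum_filter, Nat.filter_dvd_Icc_eq_divisors, ← Nat.sum_div_divisors,
    Finset.mul_sum]
  refine Finset.sum_congr rfl fun d hd => ?_
  have hdvd := Nat.dvd_of_mem_divisors hd
  have hd0 : (d : ℝ) ≠ 0 := by exact_mod_cast (Nat.pos_of_mem_divisors hd).ne'
  rw [Nat.div_div_self hdvd k.succ_ne_zero, Nat.cast_div hdvd hd0, div_pow, div_pow, one_pow]
  push_cast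
  ring
end
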